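/- arXiv:2001.03973 — 5 statements merged into one kernel-verified Lean document; each statement's English description precedes it below -/
import Mathlib

section
/- (Hyperbolicity of the RMHD symmetrization.) Assume ρ > 0, a² > 0 and h > a² (equivalently, ρ > 0, p_ρ = a² > 0 and the relativistic sound speed satisfies 0 < c_s² = a²/h < 1). Then for every u ∈ ℝ³ and every H ∈ ℝ³ the 8×8 matrix A₀, defined blockwise in the context below, is positive definite. -/
open Matrix

noncomputable section

/-- Index type for the 8 RMHD variables `(p, u, H, S)` in 3D. -/
abbrev RMHDIdx3 := (Fin 1 ⊕ Fin 3) ⊕ (Fin 3 ⊕ Fin 1)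

namespace RMHD3

variable (ρ a2 h : ℝ) (u H : Fin 3 → ℝ)

/-- The Lorentz factor `Γ = (1+|u|²)^{1/2}`. -/
def Gam : ℝ := Real.sqrt (1 + u ⬝ᵥ u)

/-- The 3-velocity `v = u/Γ`. -/
def vel : Fin 3 → ℝ := (Gam u)⁻¹ • u

/-- `B² = |H|²/Γ² + (v·H)²`. -/
def B2 : ℝ := (H ⬝ᵥ H) / (Gam u) ^ 2 + (vel u ⬝ᵥ H) ^ 2

/-- The block `𝒜`. -/
def calA : Matrix (Fin 3) (Fin 3) ℝ :=
  (ρ * h * Gam u + (H ⬝ᵥ H) / Gam u) • (1 : Matrix (Fin 3) (Fin 3) ℝ)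
    - (ρ * h * Gam u + ((H ⬝ᵥ H) + B2 u H) / Gam u) • vecMulVec (vel u) (vel u)
    - (Gam u)⁻¹ • vecMulVec H H
    + ((vel u ⬝ᵥ H) / Gam u) • (vecMulVec (vel u) H + vecMulVec H (vel u))

/-- The block `ℳ = (1/Γ)(I + u⊗u)`. -/
def calM : Matrix (Fin 3) (Fin 3) ℝ :=
  (Gam u)⁻¹ • ((1 : Matrix (Fin 3) (Fin 3) ℝ) + vecMulVec u u)

/-- The matrix `A₀` of the Freistühler–Trakhinin symmetrization. -/
def A0 : Matrix RMHDIdx3 RMHDIdx3 ℝ :=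
  fromBlocks
    (fromBlocks (of fun _ _ => Gam u / (ρ * a2)) (of fun _ j => vel u j)
      (of fun i _ => vel u i) (calA ρ h u H))
    0 0
    (fromBlocks (calM u) 0 0 (1 : Matrix (Fin 1) (Fin 1) ℝ))

end RMHD3

namespace RMHD3

lemma _root_.Matrix.PosDef.fromBlocks_zero {m n : Type*} [Fintype m] [Fintype n]
    {A : Matrix m m ℝ} {D : Matrix n n ℝ} (hA : A.PosDef) (hD : D.PosDef) :
    (fromBlocks A 0 0 D).PosDef := by
  refine PosDef.of_dotProduct_mulVec_pos
    (IsHermitian.fromBlocks hA.isHermitian (by simp) hD.isHermitian) fun x hx => ?_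
  simp only [star_trivial, fromBlocks_mulVec, dotProduct_block, zero_mulVec, add_zero, zero_add,
    Sum.elim_comp_inl, Sum.elim_comp_inr]
  have hl := hA.posSemidef.dotProduct_mulVec_nonneg (x ∘ Sum.inl)
  have hr := hD.posSemidef.dotProduct_mulVec_nonneg (x ∘ Sum.inr)
  by_cases h : x ∘ Sum.inl = 0
  · have h' : x ∘ Sum.inr ≠ 0 := fun h' => hx <| by
      ext (i | i)
      exacts [congrFun h i, congrFun h' i]
    exact add_pos_of_nonneg_of_pos hl (hD.dotProduct_mulVec_pos h')
  · exact add_pos_of_pos_of_nonneg (hA.dotProduct_mulVec_pos h) hr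

lemma Gam_sq (u : Fin 3 → ℝ) : Gam u ^ 2 = 1 + u ⬝ᵥ u :=
  Real.sq_sqrt (add_nonneg zero_le_one (dotProduct_self_star_nonneg u))

lemma Gam_pos (u : Fin 3 → ℝ) : 0 < Gam u :=
  Real.sqrt_pos.mpr (add_pos_of_pos_of_nonneg one_pos (dotProduct_self_star_nonneg u))

lemma dotProduct_sq_le (x y : Fin 3 → ℝ) : (x ⬝ᵥ y) ^ 2 ≤ (x ⬝ᵥ x) * (y ⬝ᵥ y) := by
  simpa only [dotProduct, sq] using Finset.sum_mul_sq_le_sq_mul_sq Finset.univ x y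

lemma vel_dotProduct (u y : Fin 3 → ℝ) : vel u ⬝ᵥ y = (u ⬝ᵥ y) / Gam u := by
  rw [vel, smul_dotProduct, smul_eq_mul, inv_mul_eq_div]

/-- The Lorentz factor bounds how far `y ↦ |y|² - (v·y)²` degenerates. -/
lemma dotProduct_self_le (u y : Fin 3 → ℝ) :
    y ⬝ᵥ y ≤ Gam u ^ 2 * (y ⬝ᵥ y - (vel u ⬝ᵥ y) ^ 2) := by
  have hΓ := (Gam_pos u).ne'
  have h1 : Gam u ^ 2 * (vel u ⬝ᵥ y) ^ 2 = (u ⬝ᵥ y) ^ 2 := by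
    rw [vel_dotProduct]; field_simp
  have h2 := dotProduct_sq_le u y
  rw [mul_sub, h1, Gam_sq]
  linarith

lemma vel_dotProduct_sq_le (u y : Fin 3 → ℝ) : (vel u ⬝ᵥ y) ^ 2 ≤ y ⬝ᵥ y := by
  have h1 := (dotProduct_self_star_nonneg y).trans (dotProduct_self_le u y)
  linarith [nonneg_of_mul_nonneg_right h1 (pow_pos (Gam_pos u) 2)]

/-- The quadratic form of `𝒜`: the magnetic part is a Gram determinant. -/
lemma dotProduct_calA_mulVec (ρ h : ℝ) (u H y : Fin 3 → ℝ) :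
    y ⬝ᵥ (calA ρ h u H *ᵥ y) =
      ρ * h * Gam u * (y ⬝ᵥ y - (vel u ⬝ᵥ y) ^ 2) +
        (Gam u)⁻¹ * ((H ⬝ᵥ H) * ((y - (vel u ⬝ᵥ y) • vel u) ⬝ᵥ (y - (vel u ⬝ᵥ y) • vel u)) -
          (H ⬝ᵥ (y - (vel u ⬝ᵥ y) • vel u)) ^ 2) := by
  have hΓ := (Gam_pos u).ne'
  have hv : vel u ⬝ᵥ vel u = 1 - ((Gam u) ^ 2)⁻¹ := by
    have h1 : vel u ⬝ᵥ vel u = (u ⬝ᵥ u) / Gam u ^ 2 := by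
      rw [vel_dotProduct, dotProduct_comm, vel_dotProduct]; field_simp
    rw [h1, eq_sub_of_add_eq' (Gam_sq u).symm]; field_simp
  simp only [calA, B2, add_mulVec, sub_mulVec, smul_mulVec, one_mulVec, vecMulVec_mulVec,
    dotProduct_add, dotProduct_sub, sub_dotProduct, dotProduct_smul, smul_dotProduct,
    op_smul_eq_smul, smul_eq_mul, smul_add, hv, dotProduct_comm y (vel u),
    dotProduct_comm y H, dotProduct_comm H (vel u)]
  field_simp
  ring

lemma calA_lower_bound {ρ h : ℝ} (u H y : Fin 3 → ℝ) :
    ρ * h * Gam u * (y ⬝ᵥ y - (vel u ⬝ᵥ y) ^ 2) ≤ y ⬝ᵥ (calA ρ h u H *ᵥ y) := by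
  rw [dotProduct_calA_mulVec]
  exact le_add_of_nonneg_right
    (mul_nonneg (inv_pos.mpr (Gam_pos u)).le (sub_nonneg.mpr (dotProduct_sq_le _ _)))

/-- The form of the `(p, u)` block, bounded below after completing the square in `p`. -/
lemma fluid_lower_bound {ρ a2 h : ℝ} (hρ : 0 < ρ) (ha2 : 0 < a2) (hh : a2 < h)
    (u H y : Fin 3 → ℝ) (p : ℝ) :
    Gam u / (ρ * a2) * (p + ρ * a2 / Gam u * (vel u ⬝ᵥ y)) ^ 2 +
        ρ / Gam u * (h - a2) * (y ⬝ᵥ y) ≤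
      Gam u / (ρ * a2) * p ^ 2 + 2 * p * (vel u ⬝ᵥ y) + y ⬝ᵥ (calA ρ h u H *ᵥ y) := by
  have hΓ := Gam_pos u
  refine le_trans ?_ (add_le_add_right (calA_lower_bound u H y) _)
  have h1 := mul_le_mul_of_nonneg_left (dotProduct_self_le u y) (ha2.trans hh).le
  have h2 := mul_le_mul_of_nonneg_left (vel_dotProduct_sq_le u y) ha2.le
  have h3 : 0 ≤ ρ / Gam u * (h * (Gam u ^ 2 * (y ⬝ᵥ y - (vel u ⬝ᵥ y) ^ 2)) -
      a2 * (vel u ⬝ᵥ y) ^ 2 - (h - a2) * (y ⬝ᵥ y)) :=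
    mul_nonneg (div_pos hρ hΓ).le (by linarith)
  rw [← sub_nonneg]
  refine h3.trans_eq ?_
  field_simp
  ring

lemma fluid_pos {ρ a2 h : ℝ} (hρ : 0 < ρ) (ha2 : 0 < a2) (hh : a2 < h)
    (u H y : Fin 3 → ℝ) (p : ℝ) (hpy : p ≠ 0 ∨ y ≠ 0) :
    0 < Gam u / (ρ * a2) * p ^ 2 + 2 * p * (vel u ⬝ᵥ y) + y ⬝ᵥ (calA ρ h u H *ᵥ y) := by
  have hΓ := Gam_pos u
  by_cases hy : y = 0
  · subst hy
    have hp : p ≠ 0 := hpy.resolve_right (by simp)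
    simp only [dotProduct_zero, mulVec_zero, mul_zero, add_zero]
    positivity
  · refine lt_of_lt_of_le ?_ (fluid_lower_bound hρ ha2 hh u H y p)
    have h1 : 0 < y ⬝ᵥ y := (dotProduct_self_star_nonneg y).lt_of_ne'
      (mt dotProduct_self_eq_zero.mp hy)
    have h2 := sub_pos.mpr hh
    positivity

lemma fluid_posDef {ρ a2 h : ℝ} (hρ : 0 < ρ) (ha2 : 0 < a2) (hh : a2 < h) (u H : Fin 3 → ℝ) :
    (fromBlocks (of fun _ _ => Gam u / (ρ * a2)) (of fun _ j => vel u j)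
      (of fun i _ => vel u i) (calA ρ h u H) :
        Matrix (Fin 1 ⊕ Fin 3) (Fin 1 ⊕ Fin 3) ℝ).PosDef := by
  refine PosDef.of_dotProduct_mulVec_pos (IsHermitian.fromBlocks ?_ ?_ ?_) fun x hx => ?_
  · ext; simp
  · ext; simp
  · ext i j
    simp [calA, vecMulVec_apply, one_apply, eq_comm, mul_comm, add_comm]
  · obtain ⟨p, y, rfl⟩ : ∃ (p : ℝ) (y : Fin 3 → ℝ), x = Sum.elim (fun _ => p) y :=
      ⟨x (Sum.inl 0), x ∘ Sum.inr, by
        ext (i | i)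
        exacts [congrArg (x ∘ Sum.inl) (Subsingleton.elim i 0), rfl]⟩
    have hpy : p ≠ 0 ∨ y ≠ 0 := by
      by_contra! hc
      exact hx (by ext (i | i) <;> simp [hc.1, hc.2])
    refine (fluid_pos hρ ha2 hh u H y p hpy).trans_eq ?_
    have hB : (of fun (_ : Fin 1) j => vel u j) *ᵥ y = fun _ => vel u ⬝ᵥ y := rfl
    have hC : (of fun i (_ : Fin 1) => vel u i) *ᵥ (fun _ => p) = p • vel u := by
      ext i; simp [mulVec, dotProduct, mul_comm]
    simp only [star_trivial, fromBlocks_mulVec, dotProduct_block, Sum.elim_comp_inl,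
      Sum.elim_comp_inr, hB, hC, dotProduct_add, dotProduct_smul, dotProduct_comm y (vel u)]
    simp [mulVec, dotProduct]
    ring

lemma calM_posDef (u : Fin 3 → ℝ) : (calM u).PosDef := by
  refine PosDef.smul (PosDef.one.add_posSemidef ?_) (inv_pos.mpr (Gam_pos u))
  simpa using posSemidef_vecMulVec_self_star u

end RMHD3

/-- **Hyperbolicity of the RMHD symmetrization.**
If `ρ > 0`, `a² > 0` and `h > a²` (equivalently `ρ > 0`, `p_ρ = a² > 0` and the
relativistic sound speed satisfies `0 < c_s² = a²/h < 1`), then for every `u ∈ ℝ³`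
and every `H ∈ ℝ³` the `8×8` matrix `A₀` is positive definite. -/
theorem stmt3 (ρ a2 h : ℝ) (hρ : 0 < ρ) (ha2 : 0 < a2) (hh : a2 < h)
    (u H : Fin 3 → ℝ) :
    (RMHD3.A0 ρ a2 h u H).PosDef :=
  (RMHD3.fluid_posDef hρ ha2 hh u H).fromBlocks_zero
    ((RMHD3.calM_posDef u).fromBlocks_zero PosDef.one)

end
end

section
/- (Reduction of the jump conditions to the contact discontinuity conditions.) Let φ_t, φ₂, φ₃ ∈ ℝ, D = (1+φ₂²+φ₃²)^{1/2}, n = (1, −φ₂, −φ₃)/D, σ = φ_t/D, τ₁ = (φ₂, 1, 0), τ₂ = (φ₃, 0, 1). Let two states (p^±, v^±, H^±, ρ^±) be given with ρ^± > 0, |v^±| < 1; set Γ^± = (1−|v^±|²)^{−1/2}, B²_± = |H^±|²/(Γ^±)² + (v^±·H^±)², q^± = p^± + B²_±/2, v_n^± = v^±·n, H_n^± = H^±·n, v_{τᵢ}^± = v^±·τᵢ, H_{τᵢ}^± = H^±·τᵢ, and write [g] = g^+ − g^−. Assume: (i) v_n^+ = v_n^− = σ (zero mass transfer flux 𝔧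 = 0); (ii) H_n^+ = H_n^− =: H_n and H_n ≠ 0; (iii) −H_n[H_n/Γ² + (v·H)v_n] + [q] = 0; (iv) −H_n[H_{τᵢ}/Γ² + (v·H)v_{τᵢ}] = 0 for i = 1, 2; (v) H_n[v_{τᵢ}] = 0 for i = 1, 2. Then p^+ = p^−, v^+ = v^− and H^+ = H^−. -/
open Matrix

/-- A vector orthogonal to the normal of a graph is a combination of the graph tangents. -/
theorem eq_smul_add_smul_of_dotProduct_graph_normal_eq_zero {a b D : ℝ} (hD : D ≠ 0)
    {w : Fin 3 → ℝ} (hw : w ⬝ᵥ (D⁻¹ • ![1, -a, -b]) = 0) :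
    w = w 1 • ![a, 1, 0] + w 2 • ![b, 0, 1] := by
  have h : w ⬝ᵥ ![1, -a, -b] = 0 := by
    rw [dotProduct_smul, smul_eq_mul] at hw
    exact (mul_eq_zero.mp hw).resolve_left (inv_ne_zero hD)
  simp [dotProduct, Fin.sum_univ_three] at h
  ext i
  fin_cases i
  · simp
    linarith
  · simp
  · simp

/-- If `s > 0`, the symmetric form `s ⟨w, ·⟩ + ⟨v, w⟩ ⟨v, ·⟩` is nondegenerate on the tangent
space of a graph. -/
theorem eq_zero_of_graph_tangential_form_eq_zero {a b D s : ℝ} (hD : D ≠ 0) (hs : 0 < s)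
    {v w : Fin 3 → ℝ} (hw : w ⬝ᵥ (D⁻¹ • ![1, -a, -b]) = 0)
    (h1 : s * (w ⬝ᵥ ![a, 1, 0]) + (v ⬝ᵥ w) * (v ⬝ᵥ ![a, 1, 0]) = 0)
    (h2 : s * (w ⬝ᵥ ![b, 0, 1]) + (v ⬝ᵥ w) * (v ⬝ᵥ ![b, 0, 1]) = 0) : w = 0 := by
  have hw' := eq_smul_add_smul_of_dotProduct_graph_normal_eq_zero hD hw
  have expand (u : Fin 3 → ℝ) :
      u ⬝ᵥ w = w 1 * (u ⬝ᵥ ![a, 1, 0]) + w 2 * (u ⬝ᵥ ![b, 0, 1]) := by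
    conv_lhs => rw [hw']
    simp only [dotProduct_add, dotProduct_smul, smul_eq_mul]
  have key : s * (w ⬝ᵥ w) + (v ⬝ᵥ w) ^ 2 = 0 := by
    linear_combination w 1 * h1 + w 2 * h2 + s * expand w + (v ⬝ᵥ w) * expand v
  have hnn : 0 ≤ w ⬝ᵥ w := by
    simpa using dotProduct_star_self_nonneg w
  have : w ⬝ᵥ w = 0 := by
    nlinarith [sq_nonneg (v ⬝ᵥ w), mul_nonneg hs.le hnn]
  exact dotProduct_self_eq_zero.mp this

/-- **Reduction of the RMHD jump conditions to the contact discontinuity conditions.**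
At a point of a discontinuity surface `x₁ = φ(t,x₂,x₃)` with unit normal
`n = (1,−φ₂,−φ₃)/D`, `D = (1+φ₂²+φ₃²)^{1/2}`, speed `σ = φ_t/D` and tangents
`τ₁ = (φ₂,1,0)`, `τ₂ = (φ₃,0,1)`: if the two states `(p^±, v^±, H^±, ρ^±)` with
`ρ^± > 0`, `|v^±| < 1` satisfy the jump conditions with zero mass transfer flux
(`v_n^± = σ`), `H_n^+ = H_n^- = H_n ≠ 0`, the normal momentum condition
`−H_n[H_n/Γ² + (v·H)v_n] + [q] = 0`, the tangential momentum conditions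
`−H_n[H_τᵢ/Γ² + (v·H)v_τᵢ] = 0` and the magnetic conditions `H_n[v_τᵢ] = 0`,
then `p`, `v` and `H` are continuous: `p⁺ = p⁻`, `v⁺ = v⁻`, `H⁺ = H⁻`. -/
theorem stmt5 (φt φ2 φ3 : ℝ)
    (D : ℝ) (hD : D = Real.sqrt (1 + φ2 ^ 2 + φ3 ^ 2))
    (n : Fin 3 → ℝ) (hn : n = D⁻¹ • ![1, -φ2, -φ3])
    (σ : ℝ) (hσ : σ = φt / D)
    (τ1 τ2 : Fin 3 → ℝ) (hτ1 : τ1 = ![φ2, 1, 0]) (hτ2 : τ2 = ![φ3, 0, 1])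
    (pp pm : ℝ) (vp vm Hp Hm : Fin 3 → ℝ) (ρp ρm : ℝ)
    (hρp : 0 < ρp) (hρm : 0 < ρm)
    (hvp : vp ⬝ᵥ vp < 1) (hvm : vm ⬝ᵥ vm < 1)
    (Γp : ℝ) (hΓp : Γp = (Real.sqrt (1 - vp ⬝ᵥ vp))⁻¹)
    (Γm : ℝ) (hΓm : Γm = (Real.sqrt (1 - vm ⬝ᵥ vm))⁻¹)
    (B2p : ℝ) (hB2p : B2p = (Hp ⬝ᵥ Hp) / Γp ^ 2 + (vp ⬝ᵥ Hp) ^ 2)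
    (B2m : ℝ) (hB2m : B2m = (Hm ⬝ᵥ Hm) / Γm ^ 2 + (vm ⬝ᵥ Hm) ^ 2)
    (qp : ℝ) (hqp : qp = pp + B2p / 2)
    (qm : ℝ) (hqm : qm = pm + B2m / 2)
    -- (i): zero mass transfer flux
    (hi_p : vp ⬝ᵥ n = σ) (hi_m : vm ⬝ᵥ n = σ)
    -- (ii): continuity and nonvanishing of the normal magnetic field
    (Hn : ℝ) (hii_p : Hp ⬝ᵥ n = Hn) (hii_m : Hm ⬝ᵥ n = Hn) (hHn : Hn ≠ 0)
    -- (iii): normal momentum jump condition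
    (hiii : -Hn * ((Hn / Γp ^ 2 + (vp ⬝ᵥ Hp) * (vp ⬝ᵥ n))
        - (Hn / Γm ^ 2 + (vm ⬝ᵥ Hm) * (vm ⬝ᵥ n))) + (qp - qm) = 0)
    -- (iv): tangential momentum jump conditions
    (hiv1 : -Hn * (((Hp ⬝ᵥ τ1) / Γp ^ 2 + (vp ⬝ᵥ Hp) * (vp ⬝ᵥ τ1))
        - ((Hm ⬝ᵥ τ1) / Γm ^ 2 + (vm ⬝ᵥ Hm) * (vm ⬝ᵥ τ1))) = 0)
    (hiv2 : -Hn * (((Hp ⬝ᵥ τ2) / Γp ^ 2 + (vp ⬝ᵥ Hp) * (vp ⬝ᵥ τ2))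
        - ((Hm ⬝ᵥ τ2) / Γm ^ 2 + (vm ⬝ᵥ Hm) * (vm ⬝ᵥ τ2))) = 0)
    -- (v): jump conditions from the Maxwell equations
    (hv1 : Hn * (vp ⬝ᵥ τ1 - vm ⬝ᵥ τ1) = 0)
    (hv2 : Hn * (vp ⬝ᵥ τ2 - vm ⬝ᵥ τ2) = 0) :
    pp = pm ∧ vp = vm ∧ Hp = Hm := by
  have hD0 : D ≠ 0 := by
    rw [hD]
    positivity
  subst hn hτ1 hτ2
  have hv : vp = vm := by
    have h1 := (mul_eq_zero.mp hv1).resolve_left hHn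
    have h2 := (mul_eq_zero.mp hv2).resolve_left hHn
    refine sub_eq_zero.mp (eq_zero_of_graph_tangential_form_eq_zero
      (a := φ2) (b := φ3) (v := 0) hD0 one_pos ?_ ?_ ?_)
    · rw [sub_dotProduct, hi_p, hi_m, sub_self]
    · rw [sub_dotProduct, h1]
      simp
    · rw [sub_dotProduct, h2]
      simp
  subst hv
  obtain rfl : Γp = Γm := hΓp.trans hΓm.symm
  have hΓ : 0 < (Γp ^ 2)⁻¹ := by
    have : 0 < 1 - vp ⬝ᵥ vp := sub_pos.mpr hvp
    rw [hΓp]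
    positivity
  have hH : Hp = Hm := by
    have h1 := (mul_eq_zero.mp hiv1).resolve_left (neg_ne_zero.mpr hHn)
    have h2 := (mul_eq_zero.mp hiv2).resolve_left (neg_ne_zero.mpr hHn)
    refine sub_eq_zero.mp (eq_zero_of_graph_tangential_form_eq_zero
      (a := φ2) (b := φ3) (v := vp) hD0 hΓ ?_ ?_ ?_)
    · rw [sub_dotProduct, hii_p, hii_m, sub_self]
    · rw [sub_dotProduct, dotProduct_sub]
      linear_combination h1
    · rw [sub_dotProduct, dotProduct_sub]
      linear_combination h2
  subst hH
  refine ⟨?_, rfl, rfl⟩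
  linear_combination hiii - hqp + hqm - hB2p / 2 + hB2m / 2
end

section
/- (Decomposition of the symmetrized 2D RMHD matrices.) For every ρ ≠ 0, a² ≠ 0, h ∈ ℝ, u ∈ ℝ², H ∈ ℝ², and for j = 1, 2, the 6×6 matrices defined in the context below satisfy A_j = v_j A₀ + G_j. -/
open Matrix

noncomputable section

/-- Index type for the 6 RMHD variables `(p, u, H, S)` in 2D. -/
abbrev RMHDIdx2 := (Fin 1 ⊕ Fin 2) ⊕ (Fin 2 ⊕ Fin 1)

namespace RMHD2

variable (ρ a2 h : ℝ) (u H : Fin 2 → ℝ)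

/-- The Lorentz factor `Γ = (1+|u|²)^{1/2}`. -/
def Gam : ℝ := Real.sqrt (1 + u ⬝ᵥ u)

/-- The 2D velocity `v = u/Γ`. -/
def vel : Fin 2 → ℝ := (Gam u)⁻¹ • u

/-- The spatial part of the magnetic 4-vector, `b = H/Γ + (u·H)v`. -/
def bvec : Fin 2 → ℝ := (Gam u)⁻¹ • H + (u ⬝ᵥ H) • vel u

/-- `B² = |H|²/Γ² + (v·H)²`. -/
def B2 : ℝ := (H ⬝ᵥ H) / (Gam u) ^ 2 + (vel u ⬝ᵥ H) ^ 2

/-- The block `𝒜`. -/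
def calA : Matrix (Fin 2) (Fin 2) ℝ :=
  (ρ * h * Gam u + (H ⬝ᵥ H) / Gam u) • (1 : Matrix (Fin 2) (Fin 2) ℝ)
    - (ρ * h * Gam u + ((H ⬝ᵥ H) + B2 u H) / Gam u) • vecMulVec (vel u) (vel u)
    - (Gam u)⁻¹ • vecMulVec H H
    + ((vel u ⬝ᵥ H) / Gam u) • (vecMulVec (vel u) H + vecMulVec H (vel u))

/-- The block `ℳ = (1/Γ)(I + u⊗u)`. -/
def calM : Matrix (Fin 2) (Fin 2) ℝ :=
  (Gam u)⁻¹ • ((1 : Matrix (Fin 2) (Fin 2) ℝ) + vecMulVec u u)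

/-- The block `𝒩_j`. -/
def calN (j : Fin 2) : Matrix (Fin 2) (Fin 2) ℝ :=
  (Gam u)⁻¹ • vecMulVec (bvec u H) (Pi.single j 1)
    - (vel u j / Gam u) • vecMulVec (bvec u H) (vel u)
    - (H j / (Gam u) ^ 2) • (1 : Matrix (Fin 2) (Fin 2) ℝ)

/-- The block `𝒜_j`. -/
def calAj (j : Fin 2) : Matrix (Fin 2) (Fin 2) ℝ :=
  vel u j • ((ρ * h * Gam u + (H ⬝ᵥ H) / Gam u) • (1 : Matrix (Fin 2) (Fin 2) ℝ)
      - (ρ * h * Gam u + ((H ⬝ᵥ H) - B2 u H) / Gam u) • vecMulVec (vel u) (vel u)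
      - (Gam u)⁻¹ • vecMulVec H H)
    + (H j / Gam u) •
        (((Gam u) ^ 2)⁻¹ • (vecMulVec (vel u) H + vecMulVec H (vel u))
          - (2 * (vel u ⬝ᵥ H)) •
              ((1 : Matrix (Fin 2) (Fin 2) ℝ) - vecMulVec (vel u) (vel u)))
    + ((vel u ⬝ᵥ H) / Gam u) •
        (vecMulVec H (Pi.single j 1) + vecMulVec (Pi.single j 1) H)
    - (B2 u H / Gam u) •
        (vecMulVec (vel u) (Pi.single j 1) + vecMulVec (Pi.single j 1) (vel u))

/-- The block `𝒢_j`. -/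
def calG (j : Fin 2) : Matrix (Fin 2) (Fin 2) ℝ :=
  vel u j • ((2 * B2 u H / Gam u) • vecMulVec (vel u) (vel u)
      - ((vel u ⬝ᵥ H) / Gam u) • (vecMulVec (vel u) H + vecMulVec H (vel u)))
    + (H j / Gam u) •
        (((Gam u) ^ 2)⁻¹ • (vecMulVec (vel u) H + vecMulVec H (vel u))
          - (2 * (vel u ⬝ᵥ H)) •
              ((1 : Matrix (Fin 2) (Fin 2) ℝ) - vecMulVec (vel u) (vel u)))
    + ((vel u ⬝ᵥ H) / Gam u) •
        (vecMulVec H (Pi.single j 1) + vecMulVec (Pi.single j 1) H)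
    - (B2 u H / Gam u) •
        (vecMulVec (vel u) (Pi.single j 1) + vecMulVec (Pi.single j 1) (vel u))

/-- The matrix `A₀` of the 2D symmetrized RMHD system. -/
def A0 : Matrix RMHDIdx2 RMHDIdx2 ℝ :=
  fromBlocks
    (fromBlocks (of fun _ _ => Gam u / (ρ * a2)) (of fun _ j => vel u j)
      (of fun i _ => vel u i) (calA ρ h u H))
    0 0
    (fromBlocks (calM u) 0 0 (1 : Matrix (Fin 1) (Fin 1) ℝ))

/-- The matrices `A_j`, `j = 1, 2`, of the 2D symmetrized RMHD system. -/
def Aj (j : Fin 2) : Matrix RMHDIdx2 RMHDIdx2 ℝ :=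
  fromBlocks
    (fromBlocks (of fun _ _ => u j / (ρ * a2)) (of fun _ k => (Pi.single j 1 : Fin 2 → ℝ) k)
      (of fun i _ => (Pi.single j 1 : Fin 2 → ℝ) i) (calAj ρ h u H j))
    (fromBlocks 0 0 ((calN u H j)ᵀ) 0)
    (fromBlocks 0 (calN u H j) 0 0)
    (fromBlocks (vel u j • calM u) 0 0 (of fun _ _ => vel u j))

/-- The matrices `G_j`, `j = 1, 2`. -/
def Gj (j : Fin 2) : Matrix RMHDIdx2 RMHDIdx2 ℝ :=
  fromBlocks
    (fromBlocks 0 (of fun _ k => ((Pi.single j 1 : Fin 2 → ℝ) - vel u j • vel u) k)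
      (of fun i _ => ((Pi.single j 1 : Fin 2 → ℝ) - vel u j • vel u) i) (calG u H j))
    (fromBlocks 0 0 ((calN u H j)ᵀ) 0)
    (fromBlocks 0 (calN u H j) 0 0)
    0

end RMHD2

namespace RMHD2

theorem Gam_pos (u : Fin 2 → ℝ) : 0 < Gam u :=
  Real.sqrt_pos.2 <| add_pos_of_pos_of_nonneg one_pos <|
    Finset.sum_nonneg fun i _ => mul_self_nonneg (u i)

theorem vel_mul_Gam (u : Fin 2 → ℝ) (j : Fin 2) : vel u j * Gam u = u j := by
  rw [vel, Pi.smul_apply, smul_eq_mul, mul_right_comm, inv_mul_cancel₀ (Gam_pos u).ne', one_mul]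

theorem calAj_eq (ρ h : ℝ) (u H : Fin 2 → ℝ) (j : Fin 2) :
    calAj ρ h u H j = vel u j • calA ρ h u H + calG u H j := by
  unfold calAj calA calG
  module

end RMHD2

/-- **Decomposition of the symmetrized 2D RMHD matrices: `A_j = v_j A₀ + G_j`.**
For every `ρ ≠ 0`, `a² ≠ 0`, `h ∈ ℝ`, `u, H ∈ ℝ²` and `j = 1, 2`. -/
theorem stmt9 (ρ a2 h : ℝ) (hρ : ρ ≠ 0) (ha2 : a2 ≠ 0) (u H : Fin 2 → ℝ) :
    ∀ j : Fin 2,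
      RMHD2.Aj ρ a2 h u H j
        = RMHD2.vel u j • RMHD2.A0 ρ a2 h u H + RMHD2.Gj u H j := by
  intro j
  rw [RMHD2.Aj, RMHD2.A0, RMHD2.Gj, RMHD2.calAj_eq]
  simp only [fromBlocks_smul, fromBlocks_add, smul_zero, zero_add, add_zero]
  congr 2
  · ext
    simp [← RMHD2.vel_mul_Gam u j, mul_div_assoc]
  · ext
    simp
  · ext
    simp
  · ext i k
    simp [Subsingleton.elim i k]

end
end

section
/- (Structure of the boundary matrix on a contact discontinuity.) For every ρ ≠ 0, a² ≠ 0, h ∈ ℝ, u ∈ ℝ², H ∈ ℝ² and every φ₂ ∈ ℝ, setting N = (1, −φ₂), v_N = v₁ − v₂φ₂ and H_N = H₁ − H₂φ₂, one has A₁ − v_N A₀ − φ₂ A₂ = G_N, where G_N = G₁ − φ₂ G₂ is the 6×6 matrix [[0, (N − v_N v)ᵀ, 0, 0],[N − v_N v, 𝒢_N, 𝒩_Nᵀ, 0],[0, 𝒩_N, 0, 0],[0, 0, 0, 0]], with 𝒩_N = (1/Γ)b⊗N − (v_N/Γ)b⊗v − (H_N/Γ²)I and 𝒢_N = v_N[2(B²/Γ)v⊗v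 − ((v·H)/Γ)(v⊗H+H⊗v)] + (H_N/Γ)[(1/Γ²)(v⊗H+H⊗v) − 2(v·H)(I−v⊗v)] + ((v·H)/Γ)(H⊗N + N⊗H) − (B²/Γ)(v⊗N + N⊗v). In particular, when the boundary moves with the fluid (∂_tφ = v_N), the boundary matrix A₁ − ∂_tφ·A₀ − ∂₂φ·A₂ equals G_N and does not depend on ρ, a², h. -/
open Matrix

noncomputable section

namespace RMHD2

variable (ρ a2 h : ℝ) (u H : Fin 2 → ℝ)

/-- The normal vector `N = (1, −φ₂)`. -/
def Nvec (φ2 : ℝ) : Fin 2 → ℝ := ![1, -φ2]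

/-- `v_N = v₁ − v₂φ₂`. -/
def vN (φ2 : ℝ) : ℝ := vel u 0 - vel u 1 * φ2

/-- `H_N = H₁ − H₂φ₂`. -/
def HN (φ2 : ℝ) : ℝ := H 0 - H 1 * φ2

/-- The block `𝒩_N = (1/Γ)b⊗N − (v_N/Γ)b⊗v − (H_N/Γ²)I`. -/
def calNN (φ2 : ℝ) : Matrix (Fin 2) (Fin 2) ℝ :=
  (Gam u)⁻¹ • vecMulVec (bvec u H) (Nvec φ2)
    - (vN u φ2 / Gam u) • vecMulVec (bvec u H) (vel u)
    - (HN H φ2 / (Gam u) ^ 2) • (1 : Matrix (Fin 2) (Fin 2) ℝ)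

/-- The block `𝒢_N`. -/
def calGN (φ2 : ℝ) : Matrix (Fin 2) (Fin 2) ℝ :=
  vN u φ2 • ((2 * B2 u H / Gam u) • vecMulVec (vel u) (vel u)
      - ((vel u ⬝ᵥ H) / Gam u) • (vecMulVec (vel u) H + vecMulVec H (vel u)))
    + (HN H φ2 / Gam u) •
        (((Gam u) ^ 2)⁻¹ • (vecMulVec (vel u) H + vecMulVec H (vel u))
          - (2 * (vel u ⬝ᵥ H)) •
              ((1 : Matrix (Fin 2) (Fin 2) ℝ) - vecMulVec (vel u) (vel u)))
    + ((vel u ⬝ᵥ H) / Gam u) •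
        (vecMulVec H (Nvec φ2) + vecMulVec (Nvec φ2) H)
    - (B2 u H / Gam u) •
        (vecMulVec (vel u) (Nvec φ2) + vecMulVec (Nvec φ2) (vel u))

/-- The boundary matrix `G_N`. -/
def GN (φ2 : ℝ) : Matrix RMHDIdx2 RMHDIdx2 ℝ :=
  fromBlocks
    (fromBlocks 0 (of fun _ k => (Nvec φ2 - vN u φ2 • vel u) k)
      (of fun i _ => (Nvec φ2 - vN u φ2 • vel u) i) (calGN u H φ2))
    (fromBlocks 0 0 ((calNN u H φ2)ᵀ) 0)
    (fromBlocks 0 (calNN u H φ2) 0 0)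
    0

end RMHD2

namespace RMHD2

/-- Subtracting `v_j` times the block `𝒜` from `𝒜_j` leaves `𝒢_j`. -/
theorem calAj_sub_smul_calA (ρ h : ℝ) (u H : Fin 2 → ℝ) (j : Fin 2) :
    calAj ρ h u H j - vel u j • calA ρ h u H = calG u H j := by
  unfold calAj calA calG
  module

/-- `G_j` is the part of `A_j` left after subtracting the transport term `v_j A₀`. -/
theorem Aj_sub_smul_A0 (ρ a2 h : ℝ) (u H : Fin 2 → ℝ) (j : Fin 2) :
    Aj ρ a2 h u H j - vel u j • A0 ρ a2 h u H = Gj u H j := by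
  have hΓ := (Gam_pos u).ne'
  have hp : u j / (ρ * a2) - vel u j * (Gam u / (ρ * a2)) = 0 := by
    simp only [vel, Pi.smul_apply, smul_eq_mul]
    field_simp
    simp
  unfold Aj A0 Gj
  simp only [← calAj_sub_smul_calA ρ h]
  ext ((i | i) | (i | i)) ((k | k) | (k | k)) <;> simp [hp, one_apply, eq_iff_true_of_subsingleton]

theorem Nvec_eq (φ2 : ℝ) : Nvec φ2 = Pi.single 0 1 - φ2 • Pi.single 1 1 := by
  ext i
  fin_cases i <;> simp [Nvec]

theorem calNN_eq (u H : Fin 2 → ℝ) (φ2 : ℝ) :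
    calNN u H φ2 = calN u H 0 - φ2 • calN u H 1 := by
  simp only [calNN, calN, Nvec_eq, vN, HN, vecMulVec_sub, vecMulVec_smul]
  module

theorem calGN_eq (u H : Fin 2 → ℝ) (φ2 : ℝ) :
    calGN u H φ2 = calG u H 0 - φ2 • calG u H 1 := by
  simp only [calGN, calG, Nvec_eq, vN, HN, vecMulVec_sub, vecMulVec_smul, sub_vecMulVec,
    smul_vecMulVec]
  module

theorem GN_eq (u H : Fin 2 → ℝ) (φ2 : ℝ) : GN u H φ2 = Gj u H 0 - φ2 • Gj u H 1 := by
  unfold GN Gj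
  simp only [calGN_eq, calNN_eq, Nvec_eq, vN]
  ext ((i | i) | (i | i)) ((k | k) | (k | k)) <;> simp <;> ring

end RMHD2

/-- **Structure of the boundary matrix on a contact discontinuity.**
For every `ρ ≠ 0`, `a² ≠ 0`, `h ∈ ℝ`, `u, H ∈ ℝ²` and `φ₂ ∈ ℝ`, with `N = (1, −φ₂)`,
`v_N = v₁ − v₂φ₂`, `H_N = H₁ − H₂φ₂`, one has `A₁ − v_N A₀ − φ₂ A₂ = G_N`, where
`G_N = G₁ − φ₂ G₂` is the matrix defined blockwise above.  In particular, when the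
boundary moves with the fluid (`∂_tφ = v_N`), the boundary matrix
`A₁ − ∂_tφ·A₀ − ∂₂φ·A₂` equals `G_N` and does not depend on `ρ, a², h`. -/
theorem stmt10 (ρ a2 h : ℝ) (hρ : ρ ≠ 0) (ha2 : a2 ≠ 0) (u H : Fin 2 → ℝ) (φ2 : ℝ) :
    RMHD2.Aj ρ a2 h u H 0 - RMHD2.vN u φ2 • RMHD2.A0 ρ a2 h u H
        - φ2 • RMHD2.Aj ρ a2 h u H 1 = RMHD2.GN u H φ2 ∧
      RMHD2.GN u H φ2 = RMHD2.Gj u H 0 - φ2 • RMHD2.Gj u H 1 := by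
  refine ⟨?_, RMHD2.GN_eq u H φ2⟩
  rw [RMHD2.GN_eq, ← RMHD2.Aj_sub_smul_A0 ρ a2 h, ← RMHD2.Aj_sub_smul_A0 ρ a2 h, RMHD2.vN]
  module

end
end

section
/- (Intermediate boundary quadratic form identity.) Fix a basic state û ∈ ℝ², Ĥ ∈ ℝ² and φ₂ ∈ ℝ (the same on both sides of the boundary), and set Γ̂ = (1+|û|²)^{1/2}, v̂ = û/Γ̂, b̂ = Ĥ/Γ̂ + (û·Ĥ)v̂, v̂_N = v̂₁ − v̂₂φ₂, Ĥ_N = Ĥ₁ − Ĥ₂φ₂, and let G_N be the 6×6 boundary matrix built from (û, Ĥ, φ₂) as in the context. Let two perturbations U̇^± = (ṗ^±, u̇^±, Ḣ^±, Ṡ^±) ∈ ℝ×ℝ²×ℝ²×ℝ satisfy u̇^+ = u̇^− =: u̇, and set v̇ = (1/Γ̂)(u̇ − (v̂·u̇)v̂) and v̇_N = v̇₁ − v̇₂φ₂. Then (1/2)·((G_N U̇^+)·U̇^+ − (G_N U̇^−)·U̇^−) = Γ̂[ṗ]v̇_N + v̇_N (b̂·[Ḣ]) − (Ĥ_N/Γ̂²)(u̇·[Ḣ]),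 where [ṗ] = ṗ^+ − ṗ^− and [Ḣ] = Ḣ^+ − Ḣ^−. -/
open Matrix

noncomputable section

namespace RMHD2

variable (u H : Fin 2 → ℝ)

/-- Packing of the variables `(p, u, H, S)` into a vector of `ℝ⁶`. -/
def pack (p : ℝ) (u H : Fin 2 → ℝ) (S : ℝ) : RMHDIdx2 → ℝ :=
  Sum.elim (Sum.elim (fun _ => p) u) (Sum.elim H (fun _ => S))

end RMHD2

namespace RMHD2

/-- The quadratic form of the boundary matrix, split into pressure, velocity and magnetic parts. -/
theorem GN_mulVec_pack_dotProduct (u H : Fin 2 → ℝ) (φ2 p : ℝ) (w h : Fin 2 → ℝ) (S : ℝ) :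
    (GN u H φ2 *ᵥ pack p w h S) ⬝ᵥ pack p w h S
      = 2 * (p * ((Nvec φ2 - vN u φ2 • vel u) ⬝ᵥ w)) + (calGN u H φ2 *ᵥ w) ⬝ᵥ w
        + 2 * ((calNN u H φ2 *ᵥ w) ⬝ᵥ h) := by
  simp only [GN, pack, mulVec, dotProduct, Fintype.sum_sum_type, fromBlocks_apply₁₁,
    fromBlocks_apply₁₂, fromBlocks_apply₂₁, fromBlocks_apply₂₂, Sum.elim_inl, Sum.elim_inr,
    Matrix.zero_apply, transpose_apply, of_apply, Fin.sum_univ_two, Fin.sum_univ_one]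
  ring

/-- The magnetic block paired with a velocity and a magnetic perturbation. -/
theorem calNN_mulVec_dotProduct (u H : Fin 2 → ℝ) (φ2 : ℝ) (w h : Fin 2 → ℝ) :
    (calNN u H φ2 *ᵥ w) ⬝ᵥ h
      = (Gam u)⁻¹ * ((Nvec φ2 - vN u φ2 • vel u) ⬝ᵥ w) * (bvec u H ⬝ᵥ h)
        - (HN H φ2 / Gam u ^ 2) * (w ⬝ᵥ h) := by
  simp only [calNN, sub_mulVec, smul_mulVec, vecMulVec_mulVec, one_mulVec, sub_dotProduct,
    smul_dotProduct, smul_eq_mul, op_smul_eq_smul]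
  ring

theorem Gam_ne_zero (u : Fin 2 → ℝ) : Gam u ≠ 0 := by
  have h : 0 ≤ u ⬝ᵥ u := Finset.sum_nonneg fun i _ => mul_self_nonneg (u i)
  exact (Real.sqrt_pos.2 (by linarith)).ne'

end RMHD2

/-- **Intermediate boundary quadratic form identity on the linearized contact
discontinuity.** For a basic state `(û, Ĥ, φ₂)` (the same on both sides) and two
perturbations `U̇^± = (ṗ^±, u̇^±, Ḣ^±, Ṡ^±)` with common velocity perturbation
`u̇⁺ = u̇⁻ = u̇`, setting `v̇ = (1/Γ̂)(u̇ − (v̂·u̇)v̂)` and `v̇_N = v̇₁ − v̇₂φ₂`,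
`(1/2)((G_N U̇⁺)·U̇⁺ − (G_N U̇⁻)·U̇⁻) = Γ̂[ṗ]v̇_N + v̇_N(b̂·[Ḣ]) − (Ĥ_N/Γ̂²)(u̇·[Ḣ])`. -/
theorem stmt11 (uh Hh : Fin 2 → ℝ) (φ2 : ℝ)
    (pp pm : ℝ) (up um : Fin 2 → ℝ) (Hp Hm : Fin 2 → ℝ) (Sp Sm : ℝ)
    (ud : Fin 2 → ℝ) (hup : up = ud) (hum : um = ud)
    (vd : Fin 2 → ℝ)
    (hvd : vd = (RMHD2.Gam uh)⁻¹ • (ud - (RMHD2.vel uh ⬝ᵥ ud) • RMHD2.vel uh))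
    (vdN : ℝ) (hvdN : vdN = vd 0 - vd 1 * φ2) :
    (1 / 2) * ((RMHD2.GN uh Hh φ2 *ᵥ RMHD2.pack pp up Hp Sp) ⬝ᵥ RMHD2.pack pp up Hp Sp
        - (RMHD2.GN uh Hh φ2 *ᵥ RMHD2.pack pm um Hm Sm) ⬝ᵥ RMHD2.pack pm um Hm Sm)
      = RMHD2.Gam uh * (pp - pm) * vdN
        + vdN * (RMHD2.bvec uh Hh ⬝ᵥ (Hp - Hm))
        - (RMHD2.HN Hh φ2 / (RMHD2.Gam uh) ^ 2) * (ud ⬝ᵥ (Hp - Hm)) := by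
  subst hup hum
  have hN : vdN = (RMHD2.Gam uh)⁻¹ *
      ((RMHD2.Nvec φ2 - RMHD2.vN uh φ2 • RMHD2.vel uh) ⬝ᵥ um) := by
    rw [hvdN, hvd]
    simp only [RMHD2.Nvec, RMHD2.vN, dotProduct, Fin.sum_univ_two, Pi.sub_apply, Pi.smul_apply,
      smul_eq_mul, cons_val_zero, cons_val_one]
    ring
  have hΓ : (RMHD2.Nvec φ2 - RMHD2.vN uh φ2 • RMHD2.vel uh) ⬝ᵥ um = RMHD2.Gam uh * vdN := by
    rw [hN, mul_inv_cancel_left₀ (RMHD2.Gam_ne_zero uh)]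
  simp only [RMHD2.GN_mulVec_pack_dotProduct, RMHD2.calNN_mulVec_dotProduct, hΓ,
    inv_mul_cancel_left₀ (RMHD2.Gam_ne_zero uh), dotProduct_sub]
  ring

end
end
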